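/- arXiv:2604.17639 — 3 statements merged into one kernel-verified Lean document; each statement's English description precedes it below -/
import Mathlib

section
/- Let ψ : ℝ^d → ℝ be a smooth even function, 2π-periodic in each coordinate, with Fourier expansion ψ(x) = c₀ + ½ Σ_{k∈ℤ^d\{0}} c_k cos(k·x) (c_k = c_{−k}, Σ_k |c_k| < ∞), and set f(x,μ) = 2∫_{𝕋^d} ψ(x−y) μ(dy). Then f is Lasry–Lions monotone — i.e., ∫_{𝕋^d} (f(x,μ) − f(x,ν)) (μ − ν)(dx) ≥ 0 for all Borel probability measures μ, ν on 𝕋^d — if and only if c_k ≥ 0 for every k ∈ ℤ^d \ {0}. -/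
open Real MeasureTheory

namespace LL

/-- phase -/
noncomputable def ph {d : ℕ} (k : Fin d → ℤ) (x : Fin d → ℝ) : ℝ := ∑ i, (k i : ℝ) * x i

lemma ph_cont {d : ℕ} (k : Fin d → ℤ) : Continuous (ph k) := by
  unfold ph; fun_prop

lemma ph_sub {d : ℕ} (k : Fin d → ℤ) (x y : Fin d → ℝ) : ph k (x - y) = ph k x - ph k y := by
  simp [ph, mul_sub, Finset.sum_sub_distrib]

lemma ph_add_left {d : ℕ} (k m : Fin d → ℤ) (x : Fin d → ℝ) :
    ph (k + m) x = ph k x + ph m x := by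
  simp [ph, add_mul, Finset.sum_add_distrib]

lemma ph_sub_left {d : ℕ} (k m : Fin d → ℤ) (x : Fin d → ℝ) :
    ph (k - m) x = ph k x - ph m x := by
  simp [ph, sub_mul, Finset.sum_sub_distrib]

lemma bdd_integrable {X : Type*} [TopologicalSpace X] [MeasurableSpace X] [BorelSpace X]
    [SecondCountableTopology X] (ρ : Measure X) [IsFiniteMeasure ρ] (g : X → ℝ)
    (hg : Continuous g) (M : ℝ) (hM : ∀ x, |g x| ≤ M) : Integrable g ρ :=
  Integrable.of_bound hg.aestronglyMeasurable M (Filter.Eventually.of_forall hM)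

lemma hasSum_gen {ι : Type*} [Countable ι] {X : Type*} [TopologicalSpace X] [MeasurableSpace X]
    [BorelSpace X] [SecondCountableTopology X] (ρ : Measure X) [IsProbabilityMeasure ρ]
    (a : ι → ℝ) (ha : Summable fun k => |a k|) (g : ι → X → ℝ) (hg : ∀ k, Continuous (g k))
    (M : ℝ) (hM : ∀ k x, |g k x| ≤ M) :
    HasSum (fun k => a k * ∫ x, g k x ∂ρ) (∫ x, ∑' k, a k * g k x ∂ρ) := by
  have h := hasSum_integral_of_summable_integral_norm (μ := ρ) (F := fun k x => a k * g k x)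
    (fun k => (bdd_integrable ρ (g k) (hg k) M (hM k)).const_mul _) ?_
  · simpa only [integral_const_mul] using h
  · refine Summable.of_nonneg_of_le (fun k => integral_nonneg fun x => norm_nonneg _) (fun k => ?_)
      (ha.mul_right M)
    have : ∫ x, ‖a k * g k x‖ ∂ρ ≤ ∫ x, |a k| * M ∂ρ := by
      refine integral_mono ((bdd_integrable ρ (g k) (hg k) M (hM k)).const_mul _).norm
        (integrable_const _) fun x => ?_
      simp only [norm_mul, Real.norm_eq_abs]
      exact mul_le_mul_of_nonneg_left (hM k x) (abs_nonneg _)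
    simpa using this

noncomputable def C {d : ℕ} (k : Fin d → ℤ) (μ : Measure (Fin d → ℝ)) : ℝ :=
  ∫ x, Real.cos (ph k x) ∂μ
noncomputable def S {d : ℕ} (k : Fin d → ℤ) (μ : Measure (Fin d → ℝ)) : ℝ :=
  ∫ x, Real.sin (ph k x) ∂μ

section
variable {d : ℕ} (μ ν : Measure (Fin d → ℝ)) [IsProbabilityMeasure μ] [IsProbabilityMeasure ν]

lemma cos_int (k : Fin d → ℤ) : Integrable (fun x => Real.cos (ph k x)) μ :=
  bdd_integrable μ _ (Real.continuous_cos.comp (ph_cont k)) 1 fun x => Real.abs_cos_le_one _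

lemma sin_int (k : Fin d → ℤ) : Integrable (fun x => Real.sin (ph k x)) μ :=
  bdd_integrable μ _ (Real.continuous_sin.comp (ph_cont k)) 1 fun x => Real.abs_sin_le_one _

lemma C_le (k : Fin d → ℤ) : |C k μ| ≤ 1 := by
  have := norm_integral_le_of_norm_le_const (μ := μ) (f := fun x => Real.cos (ph k x)) (C := 1)
    (Filter.Eventually.of_forall fun _ => Real.abs_cos_le_one _)
  simpa [C] using this

lemma S_le (k : Fin d → ℤ) : |S k μ| ≤ 1 := by
  have := norm_integral_le_of_norm_le_const (μ := μ) (f := fun x => Real.sin (ph k x)) (C := 1)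
    (Filter.Eventually.of_forall fun _ => Real.abs_sin_le_one _)
  simpa [S] using this

variable (ψ : (Fin d → ℝ) → ℝ) (c₀ : ℝ) (c : (Fin d → ℤ) → ℝ)
    (hcsum : Summable fun k : {k : Fin d → ℤ // k ≠ 0} => |c k.1|)
    (hexp : ∀ x, ψ x = c₀ + (1 / 2) *
      ∑' k : {k : Fin d → ℤ // k ≠ 0}, c k.1 * Real.cos (ph k.1 x))

include hcsum hexp

lemma inner (x : Fin d → ℝ) :
    HasSum (fun k : {k : Fin d → ℤ // k ≠ 0} =>
      c k.1 * (Real.cos (ph k.1 x) * C k.1 μ + Real.sin (ph k.1 x) * S k.1 μ))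
      (2 * (∫ y, ψ (x - y) ∂μ) - 2 * c₀) := by
  have hc : ∀ k : {k : Fin d → ℤ // k ≠ 0}, Continuous fun y => Real.cos (ph k.1 (x - y)) :=
    fun k => Real.continuous_cos.comp ((ph_cont k.1).comp (by fun_prop))
  have h := hasSum_gen μ (fun k : {k : Fin d → ℤ // k ≠ 0} => c k.1) hcsum
    (fun k y => Real.cos (ph k.1 (x - y))) hc 1 (fun k y => Real.abs_cos_le_one _)
  have hcts : Continuous fun y => ∑' k : {k : Fin d → ℤ // k ≠ 0},
      c k.1 * Real.cos (ph k.1 (x - y)) := by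
    refine continuous_tsum (fun k => (hc k).const_mul _) hcsum fun k y => ?_
    rw [norm_mul]
    exact mul_le_of_le_one_right (norm_nonneg _) (Real.abs_cos_le_one _)
  have hint : Integrable (fun y => ∑' k : {k : Fin d → ℤ // k ≠ 0},
      c k.1 * Real.cos (ph k.1 (x - y))) μ := by
    refine bdd_integrable μ _ hcts (∑' k : {k : Fin d → ℤ // k ≠ 0}, |c k.1|) fun y => ?_
    rw [← Real.norm_eq_abs]
    refine tsum_of_norm_bounded hcsum.hasSum fun k => ?_
    rw [norm_mul]
    exact mul_le_of_le_one_right (norm_nonneg _) (Real.abs_cos_le_one _)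
  convert h using 1
  · funext k
    congr 1
    simp only [ph_sub, Real.cos_sub]
    rw [integral_add ((cos_int μ k.1).const_mul _) ((sin_int μ k.1).const_mul _),
      integral_const_mul, integral_const_mul]
    rfl
  · simp only [hexp]
    rw [integral_add (integrable_const _) (hint.const_mul _), integral_const_mul]
    simp
    ring

lemma key : HasSum (fun k : {k : Fin d → ℤ // k ≠ 0} =>
      c k.1 * ((C k.1 μ - C k.1 ν) ^ 2 + (S k.1 μ - S k.1 ν) ^ 2))
      ((∫ x, ((2 * ∫ y, ψ (x - y) ∂μ) - (2 * ∫ y, ψ (x - y) ∂ν)) ∂μ) -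
          (∫ x, ((2 * ∫ y, ψ (x - y) ∂μ) - (2 * ∫ y, ψ (x - y) ∂ν)) ∂ν)) := by
  let g : {k : Fin d → ℤ // k ≠ 0} → (Fin d → ℝ) → ℝ := fun k x =>
    Real.cos (ph k.1 x) * (C k.1 μ - C k.1 ν) + Real.sin (ph k.1 x) * (S k.1 μ - S k.1 ν)
  have hx : ∀ x, (2 * ∫ y, ψ (x - y) ∂μ) - (2 * ∫ y, ψ (x - y) ∂ν) = ∑' k, c k.1 * g k x := by
    intro x
    have h := (inner μ ψ c₀ c hcsum hexp x).sub (inner ν ψ c₀ c hcsum hexp x)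
    rw [sub_sub_sub_cancel_right] at h
    rw [← h.tsum_eq]
    congr 1
    funext k
    simp only [g]
    ring
  have hgc : ∀ k, Continuous (g k) := fun k =>
    ((Real.continuous_cos.comp (ph_cont k.1)).mul_const _).add
      ((Real.continuous_sin.comp (ph_cont k.1)).mul_const _)
  have hgb : ∀ k x, |g k x| ≤ 4 := by
    intro k x
    have h1 : |C k.1 μ - C k.1 ν| ≤ 2 :=
      (abs_sub _ _).trans (by linarith [C_le μ k.1, C_le ν k.1])
    have h2 : |S k.1 μ - S k.1 ν| ≤ 2 :=
      (abs_sub _ _).trans (by linarith [S_le μ k.1, S_le ν k.1])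
    have h3 := mul_le_mul (Real.abs_cos_le_one (ph k.1 x)) h1 (abs_nonneg _) zero_le_one
    have h4 := mul_le_mul (Real.abs_sin_le_one (ph k.1 x)) h2 (abs_nonneg _) zero_le_one
    refine (abs_add_le _ _).trans ?_
    rw [abs_mul, abs_mul]
    linarith
  have gi : ∀ (ρ : Measure (Fin d → ℝ)) [IsProbabilityMeasure ρ] k, ∫ x, g k x ∂ρ =
      C k.1 ρ * (C k.1 μ - C k.1 ν) + S k.1 ρ * (S k.1 μ - S k.1 ν) := by
    intro ρ _ k
    simp only [g]
    rw [integral_add ((cos_int ρ k.1).mul_const _) ((sin_int ρ k.1).mul_const _),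
      integral_mul_const, integral_mul_const]
    rfl
  simp only [hx]
  have h := (hasSum_gen μ (fun k : {k : Fin d → ℤ // k ≠ 0} => c k.1) hcsum g hgc 4 hgb).sub
    (hasSum_gen ν (fun k : {k : Fin d → ℤ // k ≠ 0} => c k.1) hcsum g hgc 4 hgb)
  have e : (fun k : {k : Fin d → ℤ // k ≠ 0} =>
      c k.1 * ((C k.1 μ - C k.1 ν) ^ 2 + (S k.1 μ - S k.1 ν) ^ 2)) =
      fun k => c k.1 * ∫ x, g k x ∂μ - c k.1 * ∫ x, g k x ∂ν := by
    funext k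
    rw [gi μ, gi ν]
    ring
  rw [e]
  exact h

end

/-- uniform measure on the circle -/
noncomputable def P : Measure ℝ := (ENNReal.ofReal (2 * π))⁻¹ • volume.restrict (Set.Ioc 0 (2 * π))

instance : IsProbabilityMeasure P := by
  constructor
  have : 0 < 2 * π := by positivity
  simp only [P, Measure.smul_apply, Measure.restrict_apply MeasurableSet.univ, Set.univ_inter,
    Real.volume_Ioc, sub_zero, smul_eq_mul]
  exact ENNReal.inv_mul_cancel (by simpa using this) ENNReal.ofReal_ne_top

lemma P_exp (n : ℤ) : ∫ x, Complex.exp (Complex.I * (n * x : ℝ)) ∂P = if n = 0 then 1 else 0 := by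
  split_ifs with h
  · subst h; simp
  · have hpi : (0:ℝ) ≤ 2 * π := by positivity
    rw [P, integral_smul_measure, ← intervalIntegral.integral_of_le hpi]
    have hn : (Complex.I * n : ℂ) ≠ 0 := mul_ne_zero Complex.I_ne_zero (by exact_mod_cast h)
    have := integral_exp_mul_complex (a := 0) (b := 2 * π) hn
    have e : ∀ x : ℝ, Complex.I * ((n * x : ℝ) : ℂ) = Complex.I * n * x := by
      intro x; push_cast; ring
    simp only [e]
    rw [this]
    have : Complex.exp (Complex.I * n * (2 * π : ℝ)) = 1 := by
      rw [Complex.exp_eq_one_iff]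
      exact ⟨n, by push_cast; ring⟩
    rw [this]
    simp

noncomputable def L (d : ℕ) : Measure (Fin d → ℝ) := Measure.pi fun _ => P

instance (d : ℕ) : IsProbabilityMeasure (L d) := by unfold L; infer_instance

lemma L_exp {d : ℕ} (m : Fin d → ℤ) :
    ∫ x, Complex.exp (Complex.I * (ph m x : ℝ)) ∂(L d) = if m = 0 then 1 else 0 := by
  have e : ∀ x : Fin d → ℝ, Complex.exp (Complex.I * (ph m x : ℝ)) =
      ∏ i, Complex.exp (Complex.I * (m i * x i : ℝ)) := by
    intro x
    rw [← Complex.exp_sum, ← Finset.mul_sum]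
    simp [ph]
  simp only [e]
  rw [L, integral_fintype_prod_eq_prod (𝕜 := ℂ)
    (f := fun i (t : ℝ) => Complex.exp (Complex.I * (m i * t : ℝ)))]
  simp only [P_exp]
  split_ifs with h
  · subst h; simp
  · obtain ⟨i, hi⟩ := Function.ne_iff.1 h
    exact Finset.prod_eq_zero (Finset.mem_univ i) (if_neg hi)

lemma L_exp_int {d : ℕ} (m : Fin d → ℤ) :
    Integrable (fun x => Complex.exp (Complex.I * (ph m x : ℝ))) (L d) := by
  refine Integrable.of_bound (Continuous.aestronglyMeasurable ?_) 1
    (Filter.Eventually.of_forall fun x => ?_)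
  · have := ph_cont m
    fun_prop
  · rw [mul_comm, Complex.norm_exp_ofReal_mul_I]

lemma C_L {d : ℕ} (m : Fin d → ℤ) : C m (L d) = if m = 0 then 1 else 0 := by
  have h := integral_re (L_exp_int m)
  have e : ∀ x, RCLike.re (Complex.exp (Complex.I * (ph m x : ℝ))) = Real.cos (ph m x) := by
    intro x; rw [mul_comm]; exact Complex.exp_ofReal_mul_I_re _
  simp only [e, L_exp] at h
  rw [C, h]; split_ifs <;> simp

lemma S_L {d : ℕ} (m : Fin d → ℤ) : S m (L d) = 0 := by
  have h := integral_im (L_exp_int m)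
  have e : ∀ x, RCLike.im (Complex.exp (Complex.I * (ph m x : ℝ))) = Real.sin (ph m x) := by
    intro x; rw [mul_comm]; exact Complex.exp_ofReal_mul_I_im _
  simp only [e, L_exp] at h
  rw [S, h]; split_ifs <;> simp

noncomputable def Q {d : ℕ} (k : Fin d → ℤ) : Measure (Fin d → ℝ) :=
  (L d).withDensity fun x => ENNReal.ofReal (1 + Real.cos (ph k x))

lemma Q_int {d : ℕ} (k : Fin d → ℤ) (g : (Fin d → ℝ) → ℝ) :
    ∫ x, g x ∂(Q k) = ∫ x, (1 + Real.cos (ph k x)) * g x ∂(L d) := by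
  have hm : Measurable fun x => ENNReal.ofReal (1 + Real.cos (ph k x)) := by
    have := ph_cont k
    exact ENNReal.measurable_ofReal.comp (Continuous.measurable (by fun_prop))
  rw [Q, integral_withDensity_eq_integral_toReal_smul hm
    (Filter.Eventually.of_forall fun x => ENNReal.ofReal_lt_top)]
  congr 1
  funext x
  rw [ENNReal.toReal_ofReal (by linarith [Real.neg_one_le_cos (ph k x)]), smul_eq_mul]

lemma Q_prob {d : ℕ} (k : Fin d → ℤ) (hk : k ≠ 0) : IsProbabilityMeasure (Q k) := by
  constructor
  have h0 : Integrable (fun x => 1 + Real.cos (ph k x)) (L d) :=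
    (integrable_const _).add (cos_int _ k)
  rw [Q, withDensity_apply _ MeasurableSet.univ, Measure.restrict_univ,
    ← ofReal_integral_eq_lintegral_ofReal h0
      (Filter.Eventually.of_forall fun x => by
        show 0 ≤ 1 + Real.cos (ph k x)
        linarith [Real.neg_one_le_cos (ph k x)]),
    integral_add (integrable_const _) (cos_int _ k)]
  have := C_L k
  rw [if_neg hk, C] at this
  simp [this]

lemma C_Q {d : ℕ} (k m : Fin d → ℤ) :
    C m (Q k) - C m (L d) = 1 / 2 * (C (m - k) (L d) + C (m + k) (L d)) := by
  have e : ∀ x, (1 + Real.cos (ph k x)) * Real.cos (ph m x) =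
      Real.cos (ph m x) + (1 / 2 * Real.cos (ph (m - k) x) + 1 / 2 * Real.cos (ph (m + k) x)) := by
    intro x
    rw [ph_add_left, ph_sub_left, Real.cos_add, Real.cos_sub]; ring
  rw [C, Q_int]
  simp only [e]
  have hi : Integrable (fun x => 1 / 2 * Real.cos (ph (m - k) x) +
      1 / 2 * Real.cos (ph (m + k) x)) (L d) :=
    ((cos_int _ _).const_mul _).add ((cos_int _ _).const_mul _)
  rw [integral_add (cos_int _ m) hi,
    integral_add ((cos_int _ _).const_mul _) ((cos_int _ _).const_mul _),
    integral_const_mul, integral_const_mul]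
  simp only [C]
  ring

lemma S_Q {d : ℕ} (k m : Fin d → ℤ) : S m (Q k) = 0 := by
  have e : ∀ x, (1 + Real.cos (ph k x)) * Real.sin (ph m x) =
      Real.sin (ph m x) + (1 / 2 * Real.sin (ph (m - k) x) + 1 / 2 * Real.sin (ph (m + k) x)) := by
    intro x
    rw [ph_add_left, ph_sub_left, Real.sin_add, Real.sin_sub]; ring
  rw [S, Q_int]
  simp only [e]
  have hi : Integrable (fun x => 1 / 2 * Real.sin (ph (m - k) x) +
      1 / 2 * Real.sin (ph (m + k) x)) (L d) :=
    ((sin_int _ _).const_mul _).add ((sin_int _ _).const_mul _)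
  rw [integral_add (sin_int _ m) hi,
    integral_add ((sin_int _ _).const_mul _) ((sin_int _ _).const_mul _),
    integral_const_mul, integral_const_mul]
  have h := fun n : Fin d → ℤ => S_L n
  simp only [S] at h
  simp [h]

end LL

/-- With `ψ` a smooth even `2π`-periodic function with Fourier
expansion `ψ(x) = c₀ + ½ Σ_{k≠0} c_k cos(k·x)` (`c_k = c_{−k}`, `Σ|c_k| < ∞`) and
`f(x,μ) = 2∫ψ(x−y)μ(dy)`, the coupling `f` is Lasry–Lions monotone, i.e.
`∫ (f(x,μ)−f(x,ν)) (μ−ν)(dx) ≥ 0` for all Borel probability measures `μ, ν`, if and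
only if `c_k ≥ 0` for every `k ≠ 0`. -/
theorem lasry_lions_monotone_iff_nonneg_coeffs (d : ℕ) (ψ : (Fin d → ℝ) → ℝ)
    (hψ : ContDiff ℝ (⊤ : ℕ∞) ψ) (hψeven : ∀ x, ψ (-x) = ψ x)
    (hψper : ∀ (x : Fin d → ℝ) (i : Fin d), ψ (x + Pi.single i (2 * π)) = ψ x)
    (c₀ : ℝ) (c : (Fin d → ℤ) → ℝ) (hcsymm : ∀ k, c (-k) = c k)
    (hcsum : Summable fun k : Fin d → ℤ => |c k|)
    (hexp : ∀ x, ψ x = c₀ + (1 / 2) *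
      ∑' k : {k : Fin d → ℤ // k ≠ 0}, c k.1 * Real.cos (∑ i, (k.1 i : ℝ) * x i)) :
    (∀ μ ν : Measure (Fin d → ℝ), IsProbabilityMeasure μ → IsProbabilityMeasure ν →
        0 ≤ (∫ x, ((2 * ∫ y, ψ (x - y) ∂μ) - (2 * ∫ y, ψ (x - y) ∂ν)) ∂μ) -
          (∫ x, ((2 * ∫ y, ψ (x - y) ∂μ) - (2 * ∫ y, ψ (x - y) ∂ν)) ∂ν)) ↔
      ∀ k : Fin d → ℤ, k ≠ 0 → 0 ≤ c k := by
  have hs : Summable fun k : {k : Fin d → ℤ // k ≠ 0} => |c k.1| := hcsum.subtype _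
  have hexp' : ∀ x, ψ x = c₀ + (1 / 2) *
      ∑' k : {k : Fin d → ℤ // k ≠ 0}, c k.1 * Real.cos (LL.ph k.1 x) := hexp
  constructor
  · intro H k hk
    have := LL.Q_prob k hk
    have h0 := H (LL.Q k) (LL.L d) this inferInstance
    have hsum := LL.key (LL.Q k) (LL.L d) ψ c₀ c hs hexp'
    by_contra hneg
    push Not at hneg
    have hterm : ∀ m : {k : Fin d → ℤ // k ≠ 0}, c m.1 * ((LL.C m.1 (LL.Q k) -
        LL.C m.1 (LL.L d)) ^ 2 + (LL.S m.1 (LL.Q k) - LL.S m.1 (LL.L d)) ^ 2) ≤ 0 := by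
      intro m
      rw [LL.C_Q, LL.S_Q, LL.S_L, LL.C_L, LL.C_L]
      by_cases h1 : m.1 = k
      · rw [h1]
        exact mul_nonpos_of_nonpos_of_nonneg hneg.le (by positivity)
      by_cases h2 : m.1 = -k
      · rw [h2, hcsymm]
        exact mul_nonpos_of_nonpos_of_nonneg hneg.le (by positivity)
      rw [if_neg (sub_ne_zero.2 h1), if_neg (fun h => h2 (eq_neg_of_add_eq_zero_left h))]
      simp
    have hlt := hasSum_lt (i := (⟨k, hk⟩ : {k : Fin d → ℤ // k ≠ 0})) hterm ?_ hsum hasSum_zero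
    · linarith
    · refine mul_neg_of_neg_of_pos hneg ?_
      rw [LL.C_Q, LL.S_Q, LL.S_L, LL.C_L, LL.C_L, sub_self, if_pos rfl]
      split_ifs <;> norm_num
  · intro H μ ν hμ hν
    have h := LL.key μ ν ψ c₀ c hs hexp'
    refine HasSum.nonneg (fun k => ?_) h
    exact mul_nonneg (H k.1 k.2) (add_nonneg (sq_nonneg _) (sq_nonneg _))
end

section
/- Let T > 0, a ≥ 0, b ≥ 0, and let x : [0,T] → [0,∞) be continuous and satisfy x(s) ≤ a + b ∫₀^s (s−r)^{−1/2} x(r) dr for all s ∈ [0,T]. Then x(s) ≤ a (1 + 2b√T) exp(π b² T) for all s ∈ [0,T]. -/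
open Real MeasureTheory

lemma vg_ftc (F f : ℝ → ℝ) (p q : ℝ) (hpq : p ≤ q) (hF : ContinuousOn F (Set.Icc p q))
    (hd : ∀ r ∈ Set.Ioo p q, HasDerivAt F (f r) r) (hf : ∀ r ∈ Set.Ioo p q, 0 ≤ f r) :
    IntervalIntegrable f volume p q ∧
    ∫⁻ r in Set.Ioo p q, ENNReal.ofReal (f r) = ENNReal.ofReal (F q - F p) := by
  have hI : IntervalIntegrable f volume p q := by
    apply intervalIntegral.intervalIntegrable_deriv_of_nonneg (g := F)
    · rwa [Set.uIcc_of_le hpq]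
    · simpa [hpq] using hd
    · simpa [hpq] using hf
  refine ⟨hI, ?_⟩
  rw [← intervalIntegral.integral_eq_sub_of_hasDerivAt_of_le hpq hF hd hI,
    intervalIntegral.integral_of_le hpq, ← integral_Ioc_eq_integral_Ioo.symm]
  rw [ofReal_integral_eq_lintegral_ofReal]
  · exact ((intervalIntegrable_iff_integrableOn_Ioo_of_le hpq).1 hI)
  · exact (ae_restrict_iff' measurableSet_Ioo).2 (Filter.Eventually.of_forall hf)

noncomputable def vgK (u : ℝ) : ENNReal := ENNReal.ofReal (√u)⁻¹

lemma vgK_zero {u : ℝ} (h : u ≤ 0) : vgK u = 0 := by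
  simp [vgK, Real.sqrt_eq_zero_of_nonpos h]

lemma vgK_meas : Measurable vgK := by unfold vgK; fun_prop

lemma vg_one (s : ℝ) (hs : 0 ≤ s) :
    IntervalIntegrable (fun r => (√(s - r))⁻¹) volume 0 s ∧
    ∫⁻ r in Set.Ioo 0 s, vgK (s - r) = ENNReal.ofReal (2 * √s) := by
  have := vg_ftc (fun r => - (2 * √(s - r))) (fun r => (√(s - r))⁻¹) 0 s hs
    (by fun_prop) (fun r hr => by
      have h0 : s - r ≠ 0 := by linarith [hr.2] |> fun (h : 0 < s - r) => h.ne'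
      have h1 : HasDerivAt (fun r => s - r) (-1) r := by
        simpa using (hasDerivAt_id r).const_sub s
      refine ((h1.sqrt h0).const_mul 2).neg.congr_deriv ?_
      have : √(s - r) ≠ 0 := (Real.sqrt_pos.2 (by linarith [hr.2])).ne'
      field_simp) (fun r _ => by positivity)
  simpa [vgK] using this

lemma vg_two (s t : ℝ) :
    ∫⁻ r, vgK (s - r) * vgK (r - t) ≤
      (Set.Iio s).indicator (fun _ => ENNReal.ofReal π) t := by
  have hsupp : ∫⁻ r, vgK (s - r) * vgK (r - t) =
      ∫⁻ r in Set.Ioo t s, vgK (s - r) * vgK (r - t) := by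
    rw [← lintegral_indicator measurableSet_Ioo]
    congr 1; ext r
    by_cases hr : r ∈ Set.Ioo t s
    · simp [hr]
    · rw [Set.indicator_of_notMem hr]
      rcases le_or_gt r t with h | h
      · simp [vgK_zero (sub_nonpos.2 h)]
      · have : s ≤ r := by by_contra h'; exact hr ⟨h, not_le.1 h'⟩
        simp [vgK_zero (sub_nonpos.2 this)]
  rw [hsupp]
  by_cases hts : t < s
  · rw [Set.indicator_of_mem (by exact hts)]
    have hd : 0 < s - t := sub_pos.2 hts
    have := (vg_ftc (fun r => Real.arcsin ((2 * r - s - t) / (s - t)))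
      (fun r => (√(s - r))⁻¹ * (√(r - t))⁻¹) t s hts.le
      (by fun_prop) (fun r hr => by
        have hr1 : 0 < s - r := sub_pos.2 hr.2
        have hr2 : 0 < r - t := sub_pos.2 hr.1
        have h1 : HasDerivAt (fun r => (2 * r - s - t) / (s - t)) (2 / (s - t)) r := by
          simpa using (((((hasDerivAt_id r).const_mul 2).sub_const s).sub_const t).div_const (s - t))
        have ha : (2 * r - s - t) / (s - t) ≠ -1 := by
          intro h; rw [div_eq_iff hd.ne'] at h; linarith
        have hb : (2 * r - s - t) / (s - t) ≠ 1 := by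
          intro h; rw [div_eq_iff hd.ne'] at h; linarith
        refine ((Real.hasDerivAt_arcsin ha hb).comp r h1).congr_deriv ?_
        have e : 1 - ((2 * r - s - t) / (s - t)) ^ 2 =
            (2 * (√(s - r) * √(r - t)) / (s - t)) ^ 2 := by
          rw [div_pow, div_pow, mul_pow, mul_pow, Real.sq_sqrt hr1.le, Real.sq_sqrt hr2.le]
          field_simp; ring
        rw [e, Real.sqrt_sq (by positivity)]
        have := Real.sqrt_pos.2 hr1
        have := Real.sqrt_pos.2 hr2
        field_simp) (fun r _ => by positivity)).2
    have e2 : ∀ r, vgK (s - r) * vgK (r - t) =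
        ENNReal.ofReal ((√(s - r))⁻¹ * (√(r - t))⁻¹) := fun r => by
      rw [vgK, vgK, ENNReal.ofReal_mul (by positivity)]
    simp_rw [e2]
    rw [this]
    apply ENNReal.ofReal_le_ofReal
    have h1 : (2 * s - s - t) / (s - t) = 1 := by rw [div_eq_one_iff_eq hd.ne']; ring
    have h2 : (2 * t - s - t) / (s - t) = -1 := by rw [div_eq_iff hd.ne']; ring
    simp only [h1, h2, Real.arcsin_one, Real.arcsin_neg_one]
    linarith
  · rw [Set.Ioo_eq_empty hts]; simp

lemma vg_core (T a b : ℝ) (ha : 0 ≤ a) (hb : 0 ≤ b)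
    (x : ℝ → ℝ) (hcont : Continuous x)
    (hnonneg : ∀ s, 0 ≤ x s)
    (hineq : ∀ s ∈ Set.Icc (0:ℝ) T,
      x s ≤ a + b * ∫ r in (0:ℝ)..s, x r / Real.sqrt (s - r)) :
    ∀ s ∈ Set.Icc (0:ℝ) T,
      x s ≤ a * (1 + 2 * b * √T) + π * b ^ 2 * ∫ r in (0:ℝ)..s, x r := by
  set A := ENNReal.ofReal a
  set B := ENNReal.ofReal b
  set X : ℝ → ENNReal := (Set.Ici 0).indicator (fun r => ENNReal.ofReal (x r)) with hX
  have hXm : Measurable X := (by fun_prop : Measurable fun r => ENNReal.ofReal (x r)).indicator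
    measurableSet_Ici
  have hint : ∀ s ∈ Set.Icc (0:ℝ) T, X s ≤ A + B * ∫⁻ r, vgK (s - r) * X r := by
    intro s hs
    have hi : IntervalIntegrable (fun r => x r / √(s - r)) volume 0 s := by
      simp_rw [div_eq_mul_inv]
      exact (vg_one s hs.1).1.continuousOn_mul hcont.continuousOn
    have e : ENNReal.ofReal (∫ r in (0:ℝ)..s, x r / √(s - r)) ≤ ∫⁻ r, vgK (s - r) * X r := by
      rw [intervalIntegral.integral_of_le hs.1, ofReal_integral_eq_lintegral_ofReal hi.1
        (Filter.Eventually.of_forall fun r => div_nonneg (hnonneg r) (Real.sqrt_nonneg _))]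
      refine le_trans ?_ (setLIntegral_le_lintegral (Set.Ioc 0 s) _)
      apply setLIntegral_mono (by have := vgK_meas; fun_prop)
      intro r hr
      have : r ∈ Set.Ici (0:ℝ) := hr.1.le
      simp only [hX, Set.indicator_of_mem this, vgK]
      rw [← ENNReal.ofReal_mul (by positivity), div_eq_mul_inv, mul_comm]
    have hm : s ∈ Set.Ici (0:ℝ) := hs.1
    simp only [hX, Set.indicator_of_mem hm]
    refine (ENNReal.ofReal_le_ofReal (hineq s hs)).trans ?_
    refine ENNReal.ofReal_add_le.trans ?_
    rw [ENNReal.ofReal_mul hb]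
    gcongr
  intro s hs
  have hK := vgK_meas
  have key : X s ≤ A + B * (A * ENNReal.ofReal (2 * √s) +
      B * (ENNReal.ofReal π * ∫⁻ t in Set.Ioo 0 s, ENNReal.ofReal (x t))) := by
    refine (hint s hs).trans ?_
    gcongr
    calc ∫⁻ r, vgK (s - r) * X r
        ≤ ∫⁻ r, ((Set.Ioo 0 s).indicator (fun r => A * vgK (s - r)) r +
            B * ∫⁻ t, vgK (s - r) * vgK (r - t) * X t) := by
          apply lintegral_mono_ae
          have : ∀ᵐ r : ℝ, r ≠ 0 := by simp [ae_iff]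
          filter_upwards [this] with r hr0
          by_cases hr : r ∈ Set.Ioo 0 s
          · rw [Set.indicator_of_mem hr]
            calc _ ≤ vgK (s - r) * (A + B * ∫⁻ t, vgK (r - t) * X t) := by
                  gcongr; exact hint r ⟨hr.1.le, hr.2.le.trans hs.2⟩
              _ = _ := by
                  simp_rw [mul_assoc]
                  rw [lintegral_const_mul _ (by fun_prop)]
                  ring
          · have : vgK (s - r) * X r = 0 := by
              rcases lt_or_gt_of_ne hr0 with h | h
              · have : r ∉ Set.Ici (0:ℝ) := by simpa using h
                simp [hX, this]
              · have : s ≤ r := by by_contra h'; exact hr ⟨h, not_le.1 h'⟩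
                simp [vgK_zero (sub_nonpos.2 this)]
            rw [this]; exact zero_le
      _ = A * ENNReal.ofReal (2 * √s) +
            B * ∫⁻ t, (∫⁻ r, vgK (s - r) * vgK (r - t)) * X t := by
          rw [lintegral_add_left ((by fun_prop : Measurable fun r => A * vgK (s - r)).indicator
            measurableSet_Ioo), lintegral_indicator measurableSet_Ioo,
            lintegral_const_mul _ (by fun_prop), (vg_one s hs.1).2,
            lintegral_const_mul' _ _ ENNReal.ofReal_ne_top, lintegral_lintegral_swap]
          · congr 3; ext t
            rw [lintegral_mul_const _ (by fun_prop)]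
          · apply Measurable.aemeasurable; unfold Function.uncurry; fun_prop
      _ ≤ _ := by
          gcongr
          rw [← lintegral_const_mul _ (by fun_prop), ← lintegral_indicator measurableSet_Ioo]
          apply lintegral_mono_ae
          have : ∀ᵐ r : ℝ, r ≠ 0 := by simp [ae_iff]
          filter_upwards [this] with t ht0
          refine (mul_le_mul_left (vg_two s t) _).trans ?_
          by_cases h1 : t < s <;> by_cases h2 : 0 < t
          · simp [Set.indicator, hX, h1, h2, h2.le]
          · have : ¬ 0 ≤ t := fun h => h2 (lt_of_le_of_ne h ht0.symm)
            simp [Set.indicator, hX, this]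
          · simp [Set.indicator, h1]
          · simp [Set.indicator, h1]
  have hI : IntervalIntegrable x volume 0 s := hcont.intervalIntegrable _ _
  have e : ∫⁻ t in Set.Ioo 0 s, ENNReal.ofReal (x t) =
      ENNReal.ofReal (∫ r in (0:ℝ)..s, x r) := by
    rw [intervalIntegral.integral_of_le hs.1, integral_Ioc_eq_integral_Ioo,
      ofReal_integral_eq_lintegral_ofReal
        ((intervalIntegrable_iff_integrableOn_Ioo_of_le hs.1).1 hI)
        (Filter.Eventually.of_forall hnonneg)]
  have hJ : 0 ≤ ∫ r in (0:ℝ)..s, x r := intervalIntegral.integral_nonneg hs.1 fun r _ => hnonneg r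
  have hm : s ∈ Set.Ici (0:ℝ) := hs.1
  have hpi := Real.pi_pos.le
  rw [e, hX, Set.indicator_of_mem hm, ← ENNReal.ofReal_mul hpi, ← ENNReal.ofReal_mul hb,
    ← ENNReal.ofReal_mul ha, ← ENNReal.ofReal_add (by positivity) (by positivity),
    ← ENNReal.ofReal_mul hb, ← ENNReal.ofReal_add (by positivity) (by positivity),
    ENNReal.ofReal_le_ofReal_iff (by positivity)] at key
  have : a * b * √s ≤ a * b * √T := by
    have := Real.sqrt_le_sqrt hs.2
    gcongr
  linarith

lemma vg_gron (T C K : ℝ) (hC : 0 ≤ C) (hK : 0 ≤ K) (x : ℝ → ℝ) (hcont : Continuous x)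
    (h : ∀ s ∈ Set.Icc (0:ℝ) T, x s ≤ C + K * ∫ r in (0:ℝ)..s, x r) :
    ∀ s ∈ Set.Icc (0:ℝ) T, x s ≤ C * Real.exp (K * T) := by
  intro s hs
  have hd : ∀ t, HasDerivAt (fun s => (C + K * ∫ r in (0:ℝ)..s, x r) * Real.exp (-(K * s)))
      (K * x t * Real.exp (-(K * t)) +
        (C + K * ∫ r in (0:ℝ)..t, x r) * (Real.exp (-(K * t)) * -(K * 1))) t := fun t =>
    (((hcont.integral_hasStrictDerivAt 0 t).hasDerivAt.const_mul K).const_add C).mul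
      (((hasDerivAt_id t).const_mul K).neg.exp)
  have hanti := antitoneOn_of_deriv_nonpos (convex_Icc (0:ℝ) T)
    (fun t _ => (hd t).continuousAt.continuousWithinAt)
    (fun t _ => (hd t).differentiableAt.differentiableWithinAt)
    (fun t ht => by
      rw [(hd t).deriv]
      have := h t (interior_subset ht)
      have h2 := mul_nonneg (mul_nonneg hK (Real.exp_pos (-(K * t))).le) (sub_nonneg.2 this)
      linarith)
  have h1 := hanti (Set.left_mem_Icc.2 (hs.1.trans hs.2)) hs hs.1
  simp only [intervalIntegral.integral_same, mul_zero, add_zero, neg_zero, Real.exp_zero,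
    mul_one, Real.exp_neg] at h1
  rw [← div_eq_mul_inv, div_le_iff₀ (Real.exp_pos _)] at h1
  refine (h s hs).trans (h1.trans ?_)
  have := hs.2
  gcongr

/-- Grönwall-type inequality for a Volterra integral inequality with a
weakly singular kernel: if `x : [0,T] → [0,∞)` is continuous and
`x(s) ≤ a + b ∫₀ˢ (s−r)^{-1/2} x(r) dr` on `[0,T]`, then
`x(s) ≤ a (1 + 2b√T) exp(π b² T)` on `[0,T]`. -/
theorem volterra_gronwall (T a b : ℝ) (hT : 0 < T) (ha : 0 ≤ a) (hb : 0 ≤ b)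
    (x : ℝ → ℝ) (hcont : ContinuousOn x (Set.Icc 0 T))
    (hnonneg : ∀ s ∈ Set.Icc (0:ℝ) T, 0 ≤ x s)
    (hineq : ∀ s ∈ Set.Icc (0:ℝ) T,
      x s ≤ a + b * ∫ r in (0:ℝ)..s, x r / Real.sqrt (s - r)) :
    ∀ s ∈ Set.Icc (0:ℝ) T,
      x s ≤ a * (1 + 2 * b * Real.sqrt T) * Real.exp (π * b ^ 2 * T) := by
  set y : ℝ → ℝ := Set.IccExtend hT.le ((Set.Icc 0 T).domRestrict x) with hy
  have hyc : Continuous y := (continuousOn_iff_continuous_domRestrict.1 hcont).Icc_extend'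
  have hyx : ∀ s ∈ Set.Icc (0:ℝ) T, y s = x s := fun s hs => by
    rw [hy, Set.IccExtend_of_mem _ _ hs]; rfl
  have hyn : ∀ s, 0 ≤ y s := fun s => hnonneg _ (Set.projIcc 0 T hT.le s).2
  have hyi : ∀ s ∈ Set.Icc (0:ℝ) T,
      y s ≤ a + b * ∫ r in (0:ℝ)..s, y r / Real.sqrt (s - r) := fun s hs => by
    rw [hyx s hs]
    refine (hineq s hs).trans_eq ?_
    congr 2
    apply intervalIntegral.integral_congr
    intro r hr
    rw [Set.uIcc_of_le hs.1] at hr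
    simp only [hyx r ⟨hr.1, hr.2.trans hs.2⟩]
  intro s hs
  rw [← hyx s hs]
  exact vg_gron T _ _ (by positivity) (by positivity) y hyc
    (vg_core T a b ha hb y hyc hyn hyi) s hs
end

section
/- Let ν, ρ > 0 and 0 < κ < 2ν(ρ+ν). Suppose u, m : ℝ → ℝ are twice continuously differentiable and 2π-periodic, m > 0 with ∫₀^{2π} m = 1 and m(x) = exp(−u(x)/ν)/∫₀^{2π} exp(−u(y)/ν) dy, and the stationary Kuramoto mean-field game system holds: ρ u(x) − ν u''(x) + ½ u'(x)² = 2κ ∫₀^{2π} sin²((x−y)/2) m(y) dy for all x, and ν m'' + (m u')' = 0. Then m is identically equal to the uniform density 1/(2π), and u is constant. -/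
open Real MeasureTheory

noncomputable def fc (f : ℝ → ℂ) (n : ℤ) : ℂ :=
  (1 / (2 * π) : ℝ) • ∫ x in (0:ℝ)..(2 * π), Complex.exp (-(Complex.I * n * x)) * f x

lemma fc_parseval (f : ℝ → ℂ) (hf : Continuous f) :
    HasSum (fun n => ‖fc f n‖ ^ 2) ((1 / (2 * π)) * ∫ x in (0:ℝ)..(2 * π), ‖f x‖ ^ 2) := by
  have hab : (0:ℝ) < 2 * π := by positivity
  have hL : MemLp f 2 (volume.restrict (Set.Ioc 0 (2 * π))) := by
    obtain ⟨C, hC⟩ := (isCompact_Icc (a := (0:ℝ)) (b := 2 * π)).exists_bound_of_continuousOn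
      hf.continuousOn
    refine MemLp.of_bound hf.aestronglyMeasurable C ?_
    filter_upwards [ae_restrict_mem measurableSet_Ioc] with x hx
    exact hC x ⟨hx.1.le, hx.2⟩
  have h := hasSum_sq_fourierCoeffOn hab hL
  convert h using 1
  · funext n
    rw [fourierCoeffOn_eq_integral, fc, sub_zero]
    congr 3
    apply intervalIntegral.integral_congr
    intro x _
    simp only [fourier_coe_apply, smul_eq_mul]
    congr 2
    have : (π : ℂ) ≠ 0 := by exact_mod_cast pi_ne_zero
    push_cast
    field_simp
  · simp

lemma fc_deriv (f f' : ℝ → ℂ) (hf : ∀ x, HasDerivAt f (f' x) x) (hc : Continuous f')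
    (hper : f (2 * π) = f 0) (n : ℤ) : fc f' n = Complex.I * n * fc f n := by
  have hcf : Continuous f := continuous_iff_continuousAt.2 fun x => (hf x).continuousAt
  have hd : ∀ x : ℝ, HasDerivAt (fun x : ℝ => Complex.exp (-(Complex.I * n * x)) * f x)
      (-(Complex.I * n) * (Complex.exp (-(Complex.I * n * x)) * f x)
        + Complex.exp (-(Complex.I * n * x)) * f' x) x := by
    intro x
    have h1 : HasDerivAt (fun x : ℝ => (-(Complex.I * n * x) : ℂ)) (-(Complex.I * n)) x := by
      simpa using ((Complex.ofRealCLM.hasDerivAt (x := x)).const_mul (Complex.I * n)).fun_neg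
    have := h1.cexp.fun_mul (hf x)
    refine this.congr_deriv ?_
    ring
  have h := intervalIntegral.integral_eq_sub_of_hasDerivAt (a := 0) (b := 2 * π)
    (fun x _ => hd x) (by apply Continuous.intervalIntegrable; fun_prop)
  have e1 : Complex.exp (-(Complex.I * n * ((2 * π : ℝ) : ℂ))) = 1 := by
    rw [Complex.exp_eq_one_iff]
    refine ⟨-n, ?_⟩
    push_cast; ring
  rw [e1, hper] at h
  rw [intervalIntegral.integral_add (by apply Continuous.intervalIntegrable; fun_prop)
    (by apply Continuous.intervalIntegrable; fun_prop),
    intervalIntegral.integral_const_mul] at h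
  simp only [Complex.ofReal_zero, mul_zero, neg_zero, Complex.exp_zero, sub_self] at h
  simp only [fc, Complex.real_smul]
  linear_combination ((1 / (2 * π) : ℝ) : ℂ) * h

lemma fc_shift (f : ℝ → ℂ) (hf : Continuous f) (w : ℂ) (n : ℤ) :
    fc (fun x => f x * (1 + w * Complex.exp (Complex.I * x))) n = fc f n + w * fc f (n - 1) := by
  simp only [fc, Complex.real_smul]
  rw [mul_left_comm w, ← intervalIntegral.integral_const_mul w, ← mul_add,
    ← intervalIntegral.integral_add (by apply Continuous.intervalIntegrable; fun_prop)
    (by apply Continuous.intervalIntegrable; fun_prop)]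
  congr 1
  apply intervalIntegral.integral_congr
  intro x _
  have : Complex.exp (-(Complex.I * ((n - 1 : ℤ) : ℂ) * x))
      = Complex.exp (-(Complex.I * n * x)) * Complex.exp (Complex.I * x) := by
    rw [← Complex.exp_add]; congr 1; push_cast; ring
  simp only [this]
  ring

lemma wirtinger (g g' : ℝ → ℝ) (hg : ∀ x, HasDerivAt g (g' x) x) (hc : Continuous g')
    (hper : g (2 * π) = g 0) (h0 : ∫ x in (0:ℝ)..(2 * π), g x = 0) :
    ∫ x in (0:ℝ)..(2 * π), g x ^ 2 ≤ ∫ x in (0:ℝ)..(2 * π), g' x ^ 2 := by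
  have hcg : Continuous g := continuous_iff_continuousAt.2 fun x => (hg x).continuousAt
  have p1 := fc_parseval (fun x => (g x : ℂ)) (by fun_prop)
  have p2 := fc_parseval (fun x => (g' x : ℂ)) (by fun_prop)
  simp only [Complex.norm_real, norm_eq_abs, sq_abs] at p1 p2
  have := hasSum_le (fun n => ?_) p1 p2
  · exact le_of_mul_le_mul_left this (by positivity)
  · rw [fc_deriv _ _ (fun x => (hg x).ofReal_comp) (by fun_prop) (by simp [hper])]
    by_cases hn : n = 0
    · have : fc (fun x => (g x : ℂ)) 0 = 0 := by
        simp [fc, intervalIntegral.integral_ofReal, h0]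
      simp [hn, this]
    · rw [norm_mul, norm_mul, Complex.norm_I, one_mul, mul_pow]
      have : (1:ℝ) ≤ ‖(n:ℂ)‖ ^ 2 := by
        rw [Complex.norm_intCast, sq_abs]
        exact_mod_cast (show (1:ℤ) ≤ n ^ 2 by have := sq_pos_of_ne_zero hn; omega)
      nlinarith [sq_nonneg ‖fc (fun x => (g x : ℂ)) n‖]

lemma fisher_aux (v v' : ℝ → ℝ) (hv : ∀ x, HasDerivAt v (v' x) x) (hc : Continuous v')
    (hper : v (2 * π) = v 0) (t : ℝ) (ht : 0 < t) (α β : ℝ) (hab : α ^ 2 + β ^ 2 = 1) :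
    2 * ∫ x in (0:ℝ)..(2 * π), v x ^ 2 * (α * cos x - β * sin x) ≤
      t * (∫ x in (0:ℝ)..(2 * π), v' x ^ 2) + 2 / t * ∫ x in (0:ℝ)..(2 * π), v x ^ 2 := by
  have hcv : Continuous v := continuous_iff_continuousAt.2 fun x => (hv x).continuousAt
  set w : ℂ := ⟨α, β⟩ with hw
  have hwn : ‖w‖ = 1 := by
    rw [← sq_eq_sq₀ (norm_nonneg _) zero_le_one, ← Complex.normSq_eq_norm_sq]
    simp [Complex.normSq_apply, hw]; nlinarith
  have p1 := fc_parseval (fun x => (v x : ℂ)) (by fun_prop)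
  have p2 := fc_parseval (fun x => (v' x : ℂ)) (by fun_prop)
  have p3 := fc_parseval (fun x => (v x : ℂ) * (1 + w * Complex.exp (Complex.I * x))) (by fun_prop)
  simp only [fc_deriv _ _ (fun x => (hv x).ofReal_comp)
    (show Continuous (fun x => (v' x : ℂ)) by fun_prop)
    (show ((v (2 * π) : ℝ) : ℂ) = v 0 by simp [hper])] at p2
  simp only [fc_shift _ (show Continuous (fun x => (v x : ℂ)) by fun_prop)] at p3
  have hn3 : ∀ x : ℝ, ‖(v x : ℂ) * (1 + w * Complex.exp (Complex.I * x))‖ ^ 2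
      = 2 * v x ^ 2 + 2 * (v x ^ 2 * (α * cos x - β * sin x)) := by
    intro x
    rw [← Complex.normSq_eq_norm_sq, mul_comm Complex.I, Complex.exp_mul_I, ← Complex.ofReal_cos,
      ← Complex.ofReal_sin]
    simp [Complex.normSq_apply, hw, -Complex.ofReal_cos, -Complex.ofReal_sin]
    linear_combination (v x ^ 2 * (α ^ 2 + β ^ 2)) * sin_sq_add_cos_sq x + v x ^ 2 * hab
  simp only [hn3] at p3
  rw [intervalIntegral.integral_add (by apply Continuous.intervalIntegrable; fun_prop)
    (by apply Continuous.intervalIntegrable; fun_prop), intervalIntegral.integral_const_mul,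
    intervalIntegral.integral_const_mul] at p3
  simp only [Complex.norm_real, norm_eq_abs, sq_abs, norm_mul, Complex.norm_I, one_mul, mul_pow,
    Complex.norm_intCast] at p1 p2
  set c := fc (fun x => (v x : ℂ)) with hcdef
  set V := ∫ x in (0:ℝ)..(2 * π), v x ^ 2
  set D := ∫ x in (0:ℝ)..(2 * π), v' x ^ 2
  set Z := ∫ x in (0:ℝ)..(2 * π), v x ^ 2 * (α * cos x - β * sin x)
  -- the shifted sums
  have sh : ∀ {f : ℤ → ℝ} {s : ℝ}, HasSum f s → HasSum (fun n => f (n - 1)) s := fun {f s} h =>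
    (Equiv.subRight (1:ℤ)).hasSum_iff.2 h
  let e : ℤ → ℝ := fun n => ‖c n‖ ^ 2
  let d : ℤ → ℝ := fun n => (n:ℝ) ^ 2 * ‖c n‖ ^ 2
  have he : HasSum e (1 / (2 * π) * V) := p1
  have hd : HasSum d (1 / (2 * π) * D) := p2
  have ind : ∀ {f : ℤ → ℝ} {s : ℝ} (S : Set ℤ), HasSum f s → Summable (S.indicator f) :=
    fun S h => h.summable.indicator S
  have hdp := (ind {n | 1 ≤ n} hd).hasSum
  have hdn := (ind {n | n ≤ -1} hd).hasSum
  have hep := (ind {n | 0 ≤ n} he).hasSum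
  have hen := (ind {n | n ≤ 0} he).hasSum
  have hdsum := hasSum_le (fun n => ?_) (hdp.add hdn) hd
  have hesum := hasSum_le (fun n => ?_) (hep.add hen) (he.add he)
  have key := hasSum_le (fun n => ?_) p3 ((he.add (sh he)).add
    (((hdp.add (sh hdn)).mul_left t).add (((sh hep).add hen).mul_left (1 / t))))
  · have h2 : 1 / (2 * π) * (2 * Z) ≤ 1 / (2 * π) * (t * D + 2 / t * V) := by
      have a1 := mul_le_mul_of_nonneg_left hdsum ht.le
      have a2 := mul_le_mul_of_nonneg_left hesum (show 0 ≤ 1 / t by positivity)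
      calc _ ≤ t * (1 / (2 * π) * D) + 1 / t * (1 / (2 * π) * V + 1 / (2 * π) * V) := by linarith
        _ = _ := by ring
    exact le_of_mul_le_mul_left h2 (by positivity)
  · have hx : ‖c n + w * c (n - 1)‖ ≤ ‖c n‖ + ‖c (n - 1)‖ := by
      refine (norm_add_le _ _).trans ?_
      rw [norm_mul, hwn, one_mul]
    have hx2 : ‖c n + w * c (n - 1)‖ ^ 2 ≤ (‖c n‖ + ‖c (n - 1)‖) ^ 2 := by gcongr
    have amgm : ∀ k X Y : ℝ, 1 ≤ k ^ 2 → 0 ≤ X → 0 ≤ Y →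
        2 * X * Y ≤ t * (k ^ 2 * X ^ 2) + 1 / t * Y ^ 2 := by
      intro k X Y hk hX hY
      have : t * X ^ 2 ≤ t * (k ^ 2 * X ^ 2) := by
        gcongr; nlinarith [sq_nonneg X]
      have h3 : t * X ^ 2 + 1 / t * Y ^ 2 - 2 * X * Y = 1 / t * (t * X - Y) ^ 2 := by
        field_simp; ring
      have : 0 ≤ 1 / t * (t * X - Y) ^ 2 := by positivity
      linarith
    refine hx2.trans ?_
    by_cases hn : 1 ≤ n
    · have m1 : n ∈ {n : ℤ | 1 ≤ n} := hn
      have m2 : n - 1 ∉ {n : ℤ | n ≤ -1} := by simp; omega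
      have m3 : n - 1 ∈ {n : ℤ | 0 ≤ n} := by simp; omega
      have m4 : n ∉ {n : ℤ | n ≤ 0} := by simp; omega
      simp only [Set.indicator_of_mem m1, Set.indicator_of_notMem m2, Set.indicator_of_mem m3,
        Set.indicator_of_notMem m4]
      have hk : (1:ℝ) ≤ (n:ℝ) ^ 2 := by exact_mod_cast (by nlinarith : 1 ≤ n ^ 2)
      have := amgm n _ _ hk (norm_nonneg (c n)) (norm_nonneg (c (n - 1)))
      simp only [e, d]
      linarith
    · have m1 : n ∉ {n : ℤ | 1 ≤ n} := hn
      have m2 : n - 1 ∈ {n : ℤ | n ≤ -1} := by simp; omega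
      have m3 : n - 1 ∉ {n : ℤ | 0 ≤ n} := by simp; omega
      have m4 : n ∈ {n : ℤ | n ≤ 0} := by simp; omega
      simp only [Set.indicator_of_notMem m1, Set.indicator_of_mem m2, Set.indicator_of_notMem m3,
        Set.indicator_of_mem m4]
      have hk : (1:ℝ) ≤ ((n - 1 : ℤ):ℝ) ^ 2 := by
        exact_mod_cast (by push Not at hn; nlinarith : 1 ≤ (n - 1) ^ 2)
      have := amgm _ _ _ hk (norm_nonneg (c (n - 1))) (norm_nonneg (c n))
      simp only [e, d]
      linarith
  · have : 0 ≤ e n := by positivity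
    by_cases h1 : 0 ≤ n <;> by_cases h2 : n ≤ 0 <;> simp [Set.indicator, h1, h2] <;> linarith
  · have : 0 ≤ d n := by positivity
    by_cases h1 : 1 ≤ n <;> by_cases h2 : n ≤ -1 <;> simp [Set.indicator, h1, h2] <;>
      first | omega | linarith

lemma fisher (v v' : ℝ → ℝ) (hv : ∀ x, HasDerivAt v (v' x) x) (hc : Continuous v')
    (hper : v (2 * π) = v 0) (h1 : ∫ x in (0:ℝ)..(2 * π), v x ^ 2 = 1) :
    (∫ x in (0:ℝ)..(2 * π), v x ^ 2 * cos x) ^ 2 + (∫ x in (0:ℝ)..(2 * π), v x ^ 2 * sin x) ^ 2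
      ≤ 2 * ∫ x in (0:ℝ)..(2 * π), v' x ^ 2 := by
  have hcv : Continuous v := continuous_iff_continuousAt.2 fun x => (hv x).continuousAt
  have hD : 0 ≤ ∫ x in (0:ℝ)..(2 * π), v' x ^ 2 :=
    intervalIntegral.integral_nonneg (by positivity) fun x _ => sq_nonneg _
  set a := ∫ x in (0:ℝ)..(2 * π), v x ^ 2 * cos x
  set b := ∫ x in (0:ℝ)..(2 * π), v x ^ 2 * sin x
  rcases (show 0 ≤ a ^ 2 + b ^ 2 by positivity).eq_or_lt with h | h
  · linarith
  obtain ⟨s, hs, hs2⟩ : ∃ s : ℝ, 0 < s ∧ s ^ 2 = a ^ 2 + b ^ 2 :=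
    ⟨√(a ^ 2 + b ^ 2), by positivity, Real.sq_sqrt h.le⟩
  have := fisher_aux v v' hv hc hper (2 / s) (by positivity) (a / s) (-b / s)
    (by field_simp; linarith)
  have e : ∀ x, v x ^ 2 * (a / s * cos x - -b / s * sin x)
    = a / s * (v x ^ 2 * cos x) + b / s * (v x ^ 2 * sin x) := fun x => by ring
  simp only [e] at this
  rw [intervalIntegral.integral_add (by apply Continuous.intervalIntegrable; fun_prop)
    (by apply Continuous.intervalIntegrable; fun_prop), intervalIntegral.integral_const_mul,
    intervalIntegral.integral_const_mul, h1] at this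
  have e2 : a / s * a + b / s * b = s := by field_simp; linarith
  rw [e2] at this
  have e3 : 2 / (2 / s) * 1 = s := by field_simp
  rw [e3] at this
  rw [← hs2]
  set D := ∫ x in (0:ℝ)..(2 * π), v' x ^ 2
  have : s ≤ 2 / s * D := by linarith
  calc s ^ 2 = s * s := by ring
    _ ≤ s * (2 / s * D) := by gcongr
    _ = 2 * D := by field_simp

lemma int_per_zero (F F' : ℝ → ℝ) (hF : ∀ x, HasDerivAt F (F' x) x) (hc : Continuous F')
    (hper : F (2 * π) = F 0) : ∫ x in (0:ℝ)..(2 * π), F' x = 0 := by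
  rw [intervalIntegral.integral_eq_sub_of_hasDerivAt (fun x _ => hF x)
    (hc.intervalIntegrable _ _), hper, sub_self]

/-- In the subcritical regime `0 < κ < κ_c = 2ν(ρ+ν)`, any stationary
equilibrium `(u,m)` of the Kuramoto mean-field game on the one-dimensional torus is the
incoherent solution: `m ≡ 1/(2π)` and `u` is constant. -/
theorem kuramoto_subcritical_uniqueness (ν ρ κ : ℝ)
    (hν : 0 < ν) (hρ : 0 < ρ) (hκpos : 0 < κ) (hκ : κ < 2 * ν * (ρ + ν))
    (u m : ℝ → ℝ) (hu : ContDiff ℝ 2 u) (hm : ContDiff ℝ 2 m)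
    (huper : Function.Periodic u (2 * π)) (hmper : Function.Periodic m (2 * π))
    (hmpos : ∀ x, 0 < m x) (hmass : (∫ x in (0:ℝ)..(2 * π), m x) = 1)
    (hgibbs : ∀ x, m x =
      Real.exp (-u x / ν) / ∫ y in (0:ℝ)..(2 * π), Real.exp (-u y / ν))
    (hHJB : ∀ x, ρ * u x - ν * deriv (deriv u) x + (1 / 2) * (deriv u x) ^ 2 =
      2 * κ * ∫ y in (0:ℝ)..(2 * π), (Real.sin ((x - y) / 2)) ^ 2 * m y)
    (hFP : ∀ x, ν * deriv (deriv m) x + deriv (fun y => m y * deriv u y) x = 0) :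
    (∀ x, m x = 1 / (2 * π)) ∧ ∃ cst : ℝ, ∀ x, u x = cst := by
  have hne : ν ≠ 0 := hν.ne'
  obtain ⟨p, hp⟩ : ∃ p, p = deriv u := ⟨_, rfl⟩
  obtain ⟨q, hq⟩ : ∃ q, q = deriv p := ⟨_, rfl⟩
  have hp1 : ContDiff ℝ 1 p := by
    rw [hp]; exact (contDiff_succ_iff_deriv (n := 1).1 (by rw [one_add_one_eq_two]; exact hu)).2.2
  have hqc : Continuous q := by rw [hq]; exact hp1.continuous_deriv le_rfl
  have hpc : Continuous p := hp1.continuous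
  have huc : Continuous u := hu.continuous
  have hmc : Continuous m := hm.continuous
  have du : ∀ x, HasDerivAt u (p x) x := fun x => by
    rw [hp]; exact (hu.differentiable (by norm_num) x).hasDerivAt
  have dp : ∀ x, HasDerivAt p (q x) x := fun x => by
    rw [hq]; exact (hp1.differentiable (by norm_num) x).hasDerivAt
  rw [← hp, ← hq] at hHJB
  have u0 : u (2 * π) = u 0 := by simpa using huper 0
  have m0 : m (2 * π) = m 0 := by simpa using hmper 0
  have p0 : p (2 * π) = p 0 := by
    have : Function.Periodic p (2 * π) := by
      intro x
      rw [hp, ← deriv_comp_add_const]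
      congr 1
      funext y; exact huper y
    simpa using this 0
  set Z := ∫ y in (0:ℝ)..(2 * π), Real.exp (-u y / ν) with hZ
  have hZpos : 0 < Z := by
    have h1 := hmpos 0
    rw [hgibbs 0] at h1
    exact (div_pos_iff_of_pos_left (Real.exp_pos _)).1 h1
  -- derivatives of `m`
  have dm : ∀ x, HasDerivAt m (-(m x * p x) / ν) x := fun x => by
    have h1 : HasDerivAt (fun y => Real.exp (-u y / ν) / Z)
        (Real.exp (-u x / ν) * (-p x / ν) / Z) x :=
      (((du x).fun_neg.div_const ν).exp).div_const Z
    have h2 : m = fun y => Real.exp (-u y / ν) / Z := funext hgibbs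
    rw [← h2] at h1
    refine h1.congr_deriv ?_
    rw [hgibbs x]; ring
  have dm2 : ∀ x, HasDerivAt (fun x => -(m x * p x) / ν)
      (m x * (p x ^ 2 / ν ^ 2 - q x / ν)) x := fun x => by
    refine (((dm x).fun_mul (dp x)).fun_neg.div_const ν).congr_deriv ?_
    field_simp; ring
  -- `v = √m`
  let v : ℝ → ℝ := fun x => Real.exp (-u x / (2 * ν)) / √Z
  have hv2 : ∀ x, v x ^ 2 = m x := fun x => by
    simp only [v]
    rw [div_pow, Real.sq_sqrt hZpos.le, hgibbs x, ← Real.exp_nat_mul]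
    congr 2
    push_cast; field_simp
  have dv : ∀ x, HasDerivAt v (-(v x * p x) / (2 * ν)) x := fun x => by
    have h1 : HasDerivAt v (Real.exp (-u x / (2 * ν)) * (-p x / (2 * ν)) / √Z) x :=
      (((du x).fun_neg.div_const (2 * ν)).exp).div_const _
    refine h1.congr_deriv ?_
    simp only [v]; ring
  have dv2 : ∀ x, HasDerivAt (fun x => -(v x * p x) / (2 * ν))
      (v x * (p x ^ 2 / (4 * ν ^ 2) - q x / (2 * ν))) x := fun x => by
    refine (((dv x).fun_mul (dp x)).fun_neg.div_const (2 * ν)).congr_deriv ?_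
    field_simp; ring
  have hvc : Continuous v := continuous_iff_continuousAt.2 fun x => (dv x).continuousAt
  have v0 : v (2 * π) = v 0 := by simp only [v, u0]
  have ii : ∀ {f : ℝ → ℝ}, Continuous f → IntervalIntegrable f volume 0 (2 * π) :=
    fun h => h.intervalIntegrable _ _
  -- basic integrals
  set X := ∫ x in (0:ℝ)..(2 * π), m x * p x ^ 2 with hX
  set Y := ∫ x in (0:ℝ)..(2 * π), m x * q x ^ 2 with hY
  set P := ∫ x in (0:ℝ)..(2 * π), m x * p x ^ 4 with hP
  set Q := ∫ x in (0:ℝ)..(2 * π), m x * p x ^ 2 * q x with hQ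
  set a := ∫ x in (0:ℝ)..(2 * π), m x * cos x with ha
  set b := ∫ x in (0:ℝ)..(2 * π), m x * sin x with hb
  have hPpos : 0 ≤ P := intervalIntegral.integral_nonneg (by positivity) fun x _ => by
    have := hmpos x; positivity
  have hYpos : 0 ≤ Y := intervalIntegral.integral_nonneg (by positivity) fun x _ => by
    have := hmpos x; positivity
  have hXpos : 0 ≤ X := intervalIntegral.integral_nonneg (by positivity) fun x _ => by
    have := hmpos x; positivity
  have iP : P = 3 * ν * Q := by
    have h := int_per_zero (fun x => m x * p x ^ 3)
      (fun x => -(1 / ν) * (m x * p x ^ 4) + 3 * (m x * p x ^ 2 * q x)) (fun x => by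
        refine ((dm x).fun_mul ((dp x).fun_pow 3)).congr_deriv ?_
        push_cast; ring) (by fun_prop) (by simp only [m0, p0])
    rw [intervalIntegral.integral_add (ii (by fun_prop)) (ii (by fun_prop)),
      intervalIntegral.integral_const_mul, intervalIntegral.integral_const_mul, ← hP, ← hQ] at h
    field_simp at h
    linarith
  -- Wirtinger step
  have hXY : X ≤ Y := by
    have h := wirtinger _ _ dv2 (by fun_prop) (by simp only [v0, p0])
      (int_per_zero v _ dv (by fun_prop) v0)
    have e1 : ∀ x, (-(v x * p x) / (2 * ν)) ^ 2 = 1 / (4 * ν ^ 2) * (m x * p x ^ 2) := fun x => by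
      rw [← hv2]; field_simp; ring
    have e2 : ∀ x, (v x * (p x ^ 2 / (4 * ν ^ 2) - q x / (2 * ν))) ^ 2 =
        1 / (16 * ν ^ 4) * (m x * p x ^ 4) + (-1 / (4 * ν ^ 3) * (m x * p x ^ 2 * q x) +
          1 / (4 * ν ^ 2) * (m x * q x ^ 2)) := fun x => by
      rw [← hv2]; field_simp; ring
    simp only [e1, e2] at h
    rw [intervalIntegral.integral_add (ii (by fun_prop)) (ii (by fun_prop)),
      intervalIntegral.integral_add (ii (by fun_prop)) (ii (by fun_prop)),
      intervalIntegral.integral_const_mul, intervalIntegral.integral_const_mul,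
      intervalIntegral.integral_const_mul, intervalIntegral.integral_const_mul,
      ← hX, ← hY, ← hP, ← hQ] at h
    have hQ' : Q = P / (3 * ν) := by rw [iP]; field_simp
    rw [hQ'] at h
    have e3 : 1 / (16 * ν ^ 4) * P + (-1 / (4 * ν ^ 3) * (P / (3 * ν)) + 1 / (4 * ν ^ 2) * Y)
      = 1 / (4 * ν ^ 2) * Y - 1 / (48 * ν ^ 4) * P := by field_simp; ring
    rw [e3] at h
    have : 0 ≤ 1 / (48 * ν ^ 4) * P := by positivity
    exact le_of_mul_le_mul_left (by linarith) (show 0 < 1 / (4 * ν ^ 2) by positivity)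
  -- Fisher step
  have hF : 2 * ν ^ 2 * (a ^ 2 + b ^ 2) ≤ X := by
    have h := fisher v _ dv (by fun_prop) v0 (by simp only [hv2]; exact hmass)
    have e1 : ∀ x, (-(v x * p x) / (2 * ν)) ^ 2 = 1 / (4 * ν ^ 2) * (m x * p x ^ 2) := fun x => by
      rw [← hv2]; field_simp; ring
    simp only [e1, hv2] at h
    rw [intervalIntegral.integral_const_mul, ← ha, ← hb, ← hX] at h
    calc 2 * ν ^ 2 * (a ^ 2 + b ^ 2) ≤ 2 * ν ^ 2 * (2 * (1 / (4 * ν ^ 2) * X)) := by gcongr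
      _ = X := by field_simp; ring
  -- the interaction term
  have hint : ∀ x, 2 * κ * (∫ y in (0:ℝ)..(2 * π), (Real.sin ((x - y) / 2)) ^ 2 * m y)
      = κ * (1 - a * cos x - b * sin x) := fun x => by
    have e : ∀ y, (Real.sin ((x - y) / 2)) ^ 2 * m y =
        1 / 2 * m y + (-(cos x / 2) * (m y * cos y) + -(sin x / 2) * (m y * sin y)) := fun y => by
      have : Real.sin ((x - y) / 2) ^ 2 = 1 / 2 - cos (x - y) / 2 := by
        rw [Real.sin_sq_eq_half_sub]; congr 3; ring
      rw [this, cos_sub]; ring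
    simp only [e]
    rw [intervalIntegral.integral_add (ii (by fun_prop)) (ii (by fun_prop)),
      intervalIntegral.integral_add (ii (by fun_prop)) (ii (by fun_prop)),
      intervalIntegral.integral_const_mul, intervalIntegral.integral_const_mul,
      intervalIntegral.integral_const_mul, ← ha, ← hb, hmass]
    ring
  -- test the HJB equation with m''
  have i0 := int_per_zero _ _ dm2 (by fun_prop) (by simp only [m0, p0])
  have iu := int_per_zero (fun x => u x * (-(m x * p x) / ν))
    (fun x => -(1 / ν) * (m x * p x ^ 2) + u x * (m x * (p x ^ 2 / ν ^ 2 - q x / ν)))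
    (fun x => by
      refine ((du x).fun_mul (dm2 x)).congr_deriv ?_
      ring) (by fun_prop) (by simp only [m0, p0, u0])
  have ic := int_per_zero (fun x => (-(m x * p x) / ν) * cos x + m x * sin x)
    (fun x => m x * (p x ^ 2 / ν ^ 2 - q x / ν) * cos x + m x * cos x)
    (fun x => by
      refine (((dm2 x).fun_mul (hasDerivAt_cos x)).fun_add
        ((dm x).fun_mul (hasDerivAt_sin x))).congr_deriv ?_
      ring) (by fun_prop) (by simp [m0, p0])
  have is := int_per_zero (fun x => (-(m x * p x) / ν) * sin x - m x * cos x)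
    (fun x => m x * (p x ^ 2 / ν ^ 2 - q x / ν) * sin x + m x * sin x)
    (fun x => by
      refine (((dm2 x).fun_mul (hasDerivAt_sin x)).fun_sub
        ((dm x).fun_mul (hasDerivAt_cos x))).congr_deriv ?_
      ring) (by fun_prop) (by simp [m0, p0])
  rw [intervalIntegral.integral_add (ii (by fun_prop)) (ii (by fun_prop))] at iu ic is
  rw [intervalIntegral.integral_const_mul, ← hX] at iu
  rw [← ha] at ic
  rw [← hb] at is
  have main : ρ / ν * X + Y = κ * (a ^ 2 + b ^ 2) := by
    have e : ∀ x, ρ * (u x * (m x * (p x ^ 2 / ν ^ 2 - q x / ν))) + (m x * q x ^ 2 +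
        (-(3 / (2 * ν)) * (m x * p x ^ 2 * q x) + 1 / (2 * ν ^ 2) * (m x * p x ^ 4)))
        = κ * (m x * (p x ^ 2 / ν ^ 2 - q x / ν)) +
          (-(κ * a) * (m x * (p x ^ 2 / ν ^ 2 - q x / ν) * cos x) +
          -(κ * b) * (m x * (p x ^ 2 / ν ^ 2 - q x / ν) * sin x)) := fun x => by
      have h := hHJB x
      rw [hint x] at h
      have h2 : ρ * (u x * (m x * (p x ^ 2 / ν ^ 2 - q x / ν))) + (m x * q x ^ 2 +
        (-(3 / (2 * ν)) * (m x * p x ^ 2 * q x) + 1 / (2 * ν ^ 2) * (m x * p x ^ 4)))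
        = (ρ * u x - ν * q x + 1 / 2 * p x ^ 2) * (m x * (p x ^ 2 / ν ^ 2 - q x / ν)) := by
        field_simp; ring
      rw [h2, h]; ring
    have h := congrArg (fun f : ℝ → ℝ => ∫ x in (0:ℝ)..(2 * π), f x) (funext e)
    rw [intervalIntegral.integral_add (ii (by fun_prop)) (ii (by fun_prop)),
      intervalIntegral.integral_add (ii (by fun_prop)) (ii (by fun_prop)),
      intervalIntegral.integral_add (ii (by fun_prop)) (ii (by fun_prop)),
      intervalIntegral.integral_add (ii (by fun_prop)) (ii (by fun_prop)),
      intervalIntegral.integral_add (ii (by fun_prop)) (ii (by fun_prop)),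
      intervalIntegral.integral_const_mul, intervalIntegral.integral_const_mul,
      intervalIntegral.integral_const_mul, intervalIntegral.integral_const_mul,
      intervalIntegral.integral_const_mul, intervalIntegral.integral_const_mul,
      i0, ← hY, ← hP, ← hQ] at h
    have h3 : -(3 / (2 * ν)) * Q + 1 / (2 * ν ^ 2) * P = 0 := by
      rw [iP]; field_simp; ring
    linear_combination h - h3 - ρ * iu - κ * a * ic - κ * b * is
  have hX0 : X = 0 := by
    have hR : a ^ 2 + b ^ 2 = 0 := by
      by_contra hR
      have hR : 0 < a ^ 2 + b ^ 2 := lt_of_le_of_ne (by positivity) (Ne.symm hR)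
      have h1 : (ρ / ν + 1) * (2 * ν ^ 2 * (a ^ 2 + b ^ 2)) ≤ κ * (a ^ 2 + b ^ 2) := by
        rw [← main]
        calc _ ≤ (ρ / ν + 1) * X := by gcongr
          _ ≤ _ := by linarith
      have h2 : (ρ / ν + 1) * (2 * ν ^ 2 * (a ^ 2 + b ^ 2))
        = 2 * ν * (ρ + ν) * (a ^ 2 + b ^ 2) := by field_simp
      nlinarith
    rw [hR] at main
    have h1 : 0 ≤ ρ / ν * X := by positivity
    linarith
  -- `u' = 0` on the period
  have hp00 : ∀ x ∈ Set.Icc (0:ℝ) (2 * π), p x = 0 := by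
    intro x hx
    by_contra hpx
    have : 0 < X := intervalIntegral.integral_pos (by positivity) (by fun_prop)
      (fun y _ => by have := hmpos y; positivity)
      ⟨x, hx, by have := hmpos x; positivity⟩
    linarith
  have hu0 : ∀ x ∈ Set.Icc (0:ℝ) (2 * π), u x = u 0 := by
    intro x hx
    have h := constant_of_has_deriv_right_zero (f := u) (a := 0) (b := 2 * π) huc.continuousOn
      (fun y hy => by
        have := (du y).hasDerivWithinAt (s := Set.Ici y)
        rwa [hp00 y ⟨hy.1, hy.2.le⟩] at this)
    exact h x hx
  have huconst : ∀ x, u x = u 0 := by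
    intro x
    obtain ⟨y, hy, hxy⟩ := huper.exists_mem_Ico₀ (by positivity) x
    rw [hxy]; exact hu0 y ⟨hy.1, hy.2.le⟩
  refine ⟨fun x => ?_, u 0, huconst⟩
  rw [hgibbs x, hZ]
  simp only [huconst]
  rw [intervalIntegral.integral_const, sub_zero, smul_eq_mul]
  have := Real.exp_pos (-u 0 / ν)
  field_simp
end
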